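/- Let r₀, M̄, ℰ > 0 and let w ∈ ℝ³ be a fixed vector. There exists a constant C = C(r₀, M̄, ℰ, |w|) > 0 such that: for every N ≥ 2, every family of pairwise distinct points x_1,…,x_N ∈ ℝ³ with minimal Euclidean distance d_min, and every λ > 0 satisfying M^N(λ) ≤ M̄·N·λ³, λ³ ≤ ℰ·d_min² and λ < (3/2)·M̄^{−1/3}, the velocities u_i := 6π·(r₀/N)·∑_{j≠i} Φ(x_i−x_j)·w (i = 1,…,N) satisfy |u_i − u_j| ≤ C·|x_i−x_j| for all i ≠ j. -/

import Mathlib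

/-- The `l∞` norm of a point of `ℝ³`. -/
noncomputable def linf (x : EuclideanSpace ℝ (Fin 3)) : ℝ := max (max |x 0| |x 1|) |x 2|

/-- The particle concentration `M^N(λ)`: the supremum over centers `c ∈ ℝ³` of the number of
particles lying in the closed `l∞`-ball of center `c` and radius `r`. -/
noncomputable def Mconc (N : ℕ) (x : Fin N → EuclideanSpace ℝ (Fin 3)) (r : ℝ) : ℕ :=
  sSup { m : ℕ | ∃ c : EuclideanSpace ℝ (Fin 3), m = Nat.card {i : Fin N | linf (x i - c) ≤ r} }

/-- The Oseen tensor `Φ(x) = (1/(8π)) (|x|⁻¹ I₃ + |x|⁻³ x ⊗ x)`, viewed as a (continuous) linear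
map `ℝ³ → ℝ³`, acting by `v ↦ (1/(8π)) (|x|⁻¹ v + |x|⁻³ ⟨x, v⟩ x)`. -/
noncomputable def oseen (x : EuclideanSpace ℝ (Fin 3)) :
    EuclideanSpace ℝ (Fin 3) →L[ℝ] EuclideanSpace ℝ (Fin 3) :=
  (1 / (8 * Real.pi)) •
    (‖x‖⁻¹ • ContinuousLinearMap.id ℝ (EuclideanSpace ℝ (Fin 3)) +
      (‖x‖ ^ 3)⁻¹ • (innerSL ℝ x).smulRight x)

/-- The Euclidean norm dominates the `l∞` norm. -/
lemma linf_le_norm (v : EuclideanSpace ℝ (Fin 3)) : linf v ≤ ‖v‖ := by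
  have h : ∀ a, |v a| ≤ ‖v‖ := fun a => by
    simpa using PiLp.norm_apply_le v a
  exact max_le (max_le (h 0) (h 1)) (h 2)

lemma linf_le_iff (v : EuclideanSpace ℝ (Fin 3)) (r : ℝ) : linf v ≤ r ↔ ∀ a, |v a| ≤ r := by
  simp [linf, Fin.forall_fin_succ, and_assoc]

/-- Every `l∞`-ball of radius `r` contains at most `Mconc N x r` particles. -/
lemma card_filter_linf_le_Mconc {N : ℕ} (x : Fin N → EuclideanSpace ℝ (Fin 3)) (r : ℝ)
    (c : EuclideanSpace ℝ (Fin 3)) :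
    (Finset.univ.filter fun i => linf (x i - c) ≤ r).card ≤ Mconc N x r := by
  refine le_csSup ⟨N, ?_⟩ ⟨c, ?_⟩
  · rintro m ⟨c, rfl⟩
    exact (Finite.card_subtype_le _).trans_eq (Nat.card_fin N)
  · simp [Nat.card_eq_fintype_card, Fintype.card_subtype]

/-- Doubling the radius of the balls multiplies a bound on their particle count by at most `8`. -/
lemma card_filter_linf_le_two_mul {N : ℕ} (x : Fin N → EuclideanSpace ℝ (Fin 3)) {r K : ℝ}
    (hK : ∀ c, ((Finset.univ.filter fun i => linf (x i - c) ≤ r).card : ℝ) ≤ K)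
    (c : EuclideanSpace ℝ (Fin 3)) :
    ((Finset.univ.filter fun i => linf (x i - c) ≤ 2 * r).card : ℝ) ≤ 8 * K := by
  let p : (Fin 3 → Bool) → EuclideanSpace ℝ (Fin 3) := fun s =>
    WithLp.toLp 2 fun a => c a + if s a then r else -r
  have hsub : (Finset.univ.filter fun i => linf (x i - c) ≤ 2 * r) ⊆
      Finset.univ.biUnion fun s => Finset.univ.filter fun i => linf (x i - p s) ≤ r := by
    intro i hi
    simp only [Finset.mem_filter, Finset.mem_univ, true_and, Finset.mem_biUnion,
      linf_le_iff] at hi ⊢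
    have hsign : ∀ a, ∃ b : Bool, |(x i) a - (c a + if b then r else -r)| ≤ r := by
      intro a
      have h := abs_le.1 (hi a)
      rw [PiLp.sub_apply] at h
      rcases le_total 0 (x i a - c a) with hs | hs
      · exact ⟨true, by rw [if_pos rfl, abs_le]; constructor <;> linarith⟩
      · exact ⟨false, by rw [if_neg Bool.false_ne_true, abs_le]; constructor <;> linarith⟩
    exact Classical.skolem.1 hsign
  calc ((Finset.univ.filter fun i => linf (x i - c) ≤ 2 * r).card : ℝ)
      ≤ ∑ s, ((Finset.univ.filter fun i => linf (x i - p s) ≤ r).card : ℝ) := by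
        exact_mod_cast (Finset.card_le_card hsub).trans Finset.card_biUnion_le
    _ ≤ ∑ _s : Fin 3 → Bool, K := Finset.sum_le_sum fun s _ => hK (p s)
    _ = 8 * K := by simp

lemma card_filter_linf_le_two_pow_mul {N : ℕ} (x : Fin N → EuclideanSpace ℝ (Fin 3)) {r K : ℝ}
    (hK : ∀ c, ((Finset.univ.filter fun i => linf (x i - c) ≤ r).card : ℝ) ≤ K) (m : ℕ)
    (c : EuclideanSpace ℝ (Fin 3)) :
    ((Finset.univ.filter fun i => linf (x i - c) ≤ 2 ^ m * r).card : ℝ) ≤ 8 ^ m * K := by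
  induction m generalizing c with
  | zero => simpa using hK c
  | succ m ih =>
    rw [pow_succ', pow_succ', mul_assoc, mul_assoc]
    exact card_filter_linf_le_two_mul x ih c

/-- Dyadic summation of `|y - c|⁻²` over the particles `y ≠ c` in an `l∞`-ball of radius
`2 ^ m * r`. -/
lemma sum_filter_inv_sq_le {N : ℕ} (x : Fin N → EuclideanSpace ℝ (Fin 3)) {r K d : ℝ}
    (hr : 0 < r) (hd : 0 < d)
    (hK : ∀ c, ((Finset.univ.filter fun i => linf (x i - c) ≤ r).card : ℝ) ≤ K)
    (i : Fin N) (hsep : ∀ k, k ≠ i → d ≤ ‖x k - x i‖) (m : ℕ) :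
    ∑ k with k ≠ i ∧ linf (x k - x i) ≤ 2 ^ m * r, (‖x k - x i‖ ^ 2)⁻¹ ≤
      K / d ^ 2 + 8 * K / r ^ 2 * 2 ^ m := by
  have hK0 : 0 ≤ K := (Nat.cast_nonneg _).trans (hK 0)
  induction m with
  | zero =>
    calc ∑ k with k ≠ i ∧ linf (x k - x i) ≤ 2 ^ 0 * r, (‖x k - x i‖ ^ 2)⁻¹
        ≤ ∑ k with k ≠ i ∧ linf (x k - x i) ≤ 2 ^ 0 * r, (d ^ 2)⁻¹ := by
          refine Finset.sum_le_sum fun k hk => ?_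
          have := hsep k (Finset.mem_filter.1 hk).2.1
          gcongr
      _ ≤ ∑ k with linf (x k - x i) ≤ r, (d ^ 2)⁻¹ := by
          refine Finset.sum_le_sum_of_subset_of_nonneg ?_ fun _ _ _ => by positivity
          intro k
          simp
      _ ≤ K / d ^ 2 := by
          rw [Finset.sum_const, nsmul_eq_mul, div_eq_mul_inv]
          gcongr
          exact hK _
      _ ≤ _ := by
          have : 0 ≤ 8 * K / r ^ 2 * 2 ^ 0 := by positivity
          linarith
  | succ m ih =>
    have hsub : (Finset.univ.filter fun k => k ≠ i ∧ linf (x k - x i) ≤ 2 ^ (m + 1) * r) ⊆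
        (Finset.univ.filter fun k => k ≠ i ∧ linf (x k - x i) ≤ 2 ^ m * r) ∪
        (Finset.univ.filter fun k =>
          2 ^ m * r < linf (x k - x i) ∧ linf (x k - x i) ≤ 2 ^ (m + 1) * r) := by
      intro k
      simp only [Finset.mem_filter, Finset.mem_univ, true_and, Finset.mem_union]
      rintro ⟨h1, h2⟩
      rcases le_or_gt (linf (x k - x i)) (2 ^ m * r) with h | h
      · exact Or.inl ⟨h1, h⟩
      · exact Or.inr ⟨h, h2⟩
    have hshell : ∑ k with 2 ^ m * r < linf (x k - x i) ∧ linf (x k - x i) ≤ 2 ^ (m + 1) * r,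
        (‖x k - x i‖ ^ 2)⁻¹ ≤ 8 * K / r ^ 2 * 2 ^ m := by
      calc _ ≤ ∑ k with 2 ^ m * r < linf (x k - x i) ∧ linf (x k - x i) ≤ 2 ^ (m + 1) * r,
            ((2 ^ m * r) ^ 2)⁻¹ := by
            refine Finset.sum_le_sum fun k hk => ?_
            have := (Finset.mem_filter.1 hk).2.1.le.trans (linf_le_norm _)
            gcongr
        _ ≤ ∑ k with linf (x k - x i) ≤ 2 ^ (m + 1) * r, ((2 ^ m * r) ^ 2)⁻¹ := by
            refine Finset.sum_le_sum_of_subset_of_nonneg ?_ fun _ _ _ => by positivity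
            intro k
            simp
        _ ≤ 8 ^ (m + 1) * K * ((2 ^ m * r) ^ 2)⁻¹ := by
            rw [Finset.sum_const, nsmul_eq_mul]
            gcongr
            exact card_filter_linf_le_two_pow_mul x hK (m + 1) (x i)
        _ = 8 * K / r ^ 2 * 2 ^ m := by
            rw [show (8 : ℝ) = 2 ^ 3 by norm_num, ← pow_mul]
            field_simp
            ring
    calc _ ≤ _ := Finset.sum_le_sum_of_subset_of_nonneg hsub fun _ _ _ => by positivity
      _ = _ := Finset.sum_union (Finset.disjoint_filter.2 fun k _ h h' => h'.1.not_ge h.2)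
      _ ≤ (K / d ^ 2 + 8 * K / r ^ 2 * 2 ^ m) + 8 * K / r ^ 2 * 2 ^ m := add_le_add ih hshell
      _ = _ := by ring

/-- Bound on the full sum of inverse squared distances to a particle. -/
lemma sum_inv_sq_le {N : ℕ} (x : Fin N → EuclideanSpace ℝ (Fin 3)) {r K d : ℝ}
    (hr : 0 < r) (hd : 0 < d)
    (hK : ∀ c, ((Finset.univ.filter fun i => linf (x i - c) ≤ r).card : ℝ) ≤ K)
    (i : Fin N) (hsep : ∀ k, k ≠ i → d ≤ ‖x k - x i‖) :
    ∑ k with k ≠ i, (‖x k - x i‖ ^ 2)⁻¹ ≤ K / d ^ 2 + 16 * K / r ^ 3 * (1 + r) + N := by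
  have hK0 : 0 ≤ K := (Nat.cast_nonneg _).trans (hK 0)
  obtain ⟨m, hm1, hm2⟩ : ∃ m : ℕ, 1 ≤ 2 ^ m * r ∧ 2 ^ m * r ≤ 2 * (1 + r) := by
    rcases le_or_gt 1 r with h | h
    · exact ⟨0, by simpa, by norm_num; linarith⟩
    · obtain ⟨m, h1, h2⟩ := exists_nat_pow_near (one_le_inv₀ hr |>.2 h.le) one_lt_two
      refine ⟨m + 1, ?_, ?_⟩
      · have := mul_le_mul_of_nonneg_right h2.le hr.le
        rwa [inv_mul_cancel₀ hr.ne'] at this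
      · have := mul_le_mul_of_nonneg_right h1 hr.le
        rw [inv_mul_cancel₀ hr.ne'] at this
        rw [pow_succ]
        linarith
  rw [← Finset.sum_filter_add_sum_filter_not _ (fun k => linf (x k - x i) ≤ 2 ^ m * r),
    Finset.filter_filter, Finset.filter_filter]
  refine add_le_add ((sum_filter_inv_sq_le x hr hd hK i hsep m).trans ?_) ?_
  · refine add_le_add le_rfl ?_
    calc 8 * K / r ^ 2 * 2 ^ m = 8 * K / r ^ 3 * (2 ^ m * r) := by field_simp
      _ ≤ 8 * K / r ^ 3 * (2 * (1 + r)) := by gcongr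
      _ = _ := by ring
  · calc _ ≤ ∑ k with k ≠ i ∧ ¬ linf (x k - x i) ≤ 2 ^ m * r, (1 : ℝ) := by
          refine Finset.sum_le_sum fun k hk => ?_
          have h := not_le.1 (Finset.mem_filter.1 hk).2.2
          exact inv_le_one_of_one_le₀
            (one_le_pow₀ (hm1.trans (h.le.trans (linf_le_norm _))))
      _ ≤ N := by
          rw [Finset.sum_const, nsmul_eq_mul, mul_one]
          exact_mod_cast (Finset.card_le_univ _).trans_eq (Fintype.card_fin N)

lemma oseen_apply (x w : EuclideanSpace ℝ (Fin 3)) :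
    oseen x w = (1 / (8 * Real.pi)) •
      (‖x‖⁻¹ • w + ((‖x‖ ^ 3)⁻¹ * inner ℝ x w) • x) := by
  simp [oseen, smul_smul, mul_assoc]

lemma oseen_neg (x : EuclideanSpace ℝ (Fin 3)) : oseen (-x) = oseen x := by
  ext1 w
  simp [oseen_apply]

/-- Local Lipschitz estimate for the Oseen tensor. -/
lemma norm_oseen_sub_oseen_le {x y : EuclideanSpace ℝ (Fin 3)} (hx : x ≠ 0) (hy : y ≠ 0)
    (w : EuclideanSpace ℝ (Fin 3)) :
    ‖oseen x w - oseen y w‖ ≤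
      3 / (8 * Real.pi) * ‖w‖ * ‖x - y‖ * ((‖x‖ ^ 2)⁻¹ + (‖y‖ ^ 2)⁻¹) := by
  have hx' : 0 < ‖x‖ := norm_pos_iff.2 hx
  have hy' : 0 < ‖y‖ := norm_pos_iff.2 hy
  set e := ‖x‖⁻¹ • x with he
  set f := ‖y‖⁻¹ • y with hf
  have hne : ‖e‖ = 1 := by simp [he, norm_smul, hx'.ne']
  have hnf : ‖f‖ = 1 := by simp [hf, norm_smul, hy'.ne']
  have hinv : |‖x‖⁻¹ - ‖y‖⁻¹| ≤ ‖x - y‖ * (‖x‖⁻¹ * ‖y‖⁻¹) := by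
    have : ‖x‖⁻¹ - ‖y‖⁻¹ = (‖y‖ - ‖x‖) * (‖x‖⁻¹ * ‖y‖⁻¹) := by field_simp
    rw [this, abs_mul, abs_of_pos (by positivity : 0 < ‖x‖⁻¹ * ‖y‖⁻¹), norm_sub_rev]
    gcongr
    exact abs_norm_sub_norm_le y x
  have hef : ‖e - f‖ ≤ 2 * (‖x - y‖ * ‖x‖⁻¹) := by
    have : e - f = ‖x‖⁻¹ • (x - y) + (‖x‖⁻¹ - ‖y‖⁻¹) • y := by
      rw [he, hf]; module
    rw [this]
    refine (norm_add_le _ _).trans ?_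
    rw [norm_smul, norm_smul, norm_inv, norm_norm, Real.norm_eq_abs]
    have := mul_le_mul_of_nonneg_right hinv hy'.le
    have h2 : ‖x - y‖ * (‖x‖⁻¹ * ‖y‖⁻¹) * ‖y‖ = ‖x - y‖ * ‖x‖⁻¹ := by field_simp
    linarith
  have key : oseen x w - oseen y w = (1 / (8 * Real.pi)) •
      ((‖x‖⁻¹ - ‖y‖⁻¹) • (w + inner ℝ e w • e) +
        ‖y‖⁻¹ • (inner ℝ (e - f) w • e + inner ℝ f w • (e - f))) := by
    have h1 : ((‖x‖ ^ 3)⁻¹ * inner ℝ x w) • x = (‖x‖⁻¹ * inner ℝ e w) • e := by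
      rw [he, real_inner_smul_left, smul_smul]; congr 1; field_simp
    have h2 : ((‖y‖ ^ 3)⁻¹ * inner ℝ y w) • y = (‖y‖⁻¹ * inner ℝ f w) • f := by
      rw [hf, real_inner_smul_left, smul_smul]; congr 1; field_simp
    rw [oseen_apply, oseen_apply, h1, h2, inner_sub_left]
    module
  have hA : ‖w + inner ℝ e w • e‖ ≤ 2 * ‖w‖ := by
    refine (norm_add_le _ _).trans ?_
    rw [norm_smul, hne]
    have := norm_inner_le_norm (𝕜 := ℝ) e w
    rw [hne] at this
    linarith
  have hB : ‖inner ℝ (e - f) w • e + inner ℝ f w • (e - f)‖ ≤ 2 * ‖w‖ * ‖e - f‖ := by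
    refine (norm_add_le _ _).trans ?_
    rw [norm_smul _ e, norm_smul _ (e - f), hne]
    have h1 := norm_inner_le_norm (𝕜 := ℝ) (e - f) w
    have h2 := norm_inner_le_norm (𝕜 := ℝ) f w
    rw [hnf] at h2
    have := mul_le_mul_of_nonneg_right h2 (norm_nonneg (e - f))
    linarith
  have hamgm : 2 * (‖x‖⁻¹ * ‖y‖⁻¹) ≤ (‖x‖ ^ 2)⁻¹ + (‖y‖ ^ 2)⁻¹ := by
    rw [← inv_pow, ← inv_pow]
    nlinarith [sq_nonneg (‖x‖⁻¹ - ‖y‖⁻¹)]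
  rw [key, norm_smul, Real.norm_of_nonneg (by positivity)]
  calc _ ≤ 1 / (8 * Real.pi) * (‖x - y‖ * (‖x‖⁻¹ * ‖y‖⁻¹) * (2 * ‖w‖) +
        ‖y‖⁻¹ * (2 * ‖w‖ * (2 * (‖x - y‖ * ‖x‖⁻¹)))) := by
        gcongr
        refine (norm_add_le _ _).trans (add_le_add ?_ ?_)
        · rw [norm_smul, Real.norm_eq_abs]
          gcongr
        · rw [norm_smul, norm_inv, norm_norm]
          gcongr
          exact hB.trans (by gcongr)
    _ = 3 / (8 * Real.pi) * ‖w‖ * ‖x - y‖ * (2 * (‖x‖⁻¹ * ‖y‖⁻¹)) := by ring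
    _ ≤ _ := by gcongr

/-- The self-interaction cancels in the difference of two velocities, since `oseen` is even. -/
lemma sum_oseen_sub_sum_oseen {N : ℕ} (x : Fin N → EuclideanSpace ℝ (Fin 3)) {i j : Fin N}
    (hij : i ≠ j) (w : EuclideanSpace ℝ (Fin 3)) :
    ∑ k with k ≠ i, oseen (x i - x k) w - ∑ k with k ≠ j, oseen (x j - x k) w =
      ∑ k with k ≠ i ∧ k ≠ j, (oseen (x i - x k) w - oseen (x j - x k) w) := by
  have h : ∀ a b : Fin N, a ≠ b → ∀ g : Fin N → EuclideanSpace ℝ (Fin 3),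
      ∑ k with k ≠ a, g k = g b + ∑ k with k ≠ a ∧ k ≠ b, g k := by
    intro a b hab g
    rw [← Finset.add_sum_erase _ g (by simpa using hab.symm : b ∈ _)]
    congr 2
    ext k
    simp [and_comm]
  rw [h i j hij, h j i hij.symm, ← neg_sub (x i) (x j), oseen_neg, add_sub_add_left_eq_sub,
    Finset.sum_sub_distrib]
  simp only [and_comm]

theorem stmt8 (r0 Mbar Ecal : ℝ) (hr0 : 0 < r0) (hMbar : 0 < Mbar) (hEcal : 0 < Ecal)
    (w : EuclideanSpace ℝ (Fin 3)) :
    ∃ C : ℝ, 0 < C ∧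
      ∀ (N : ℕ), 2 ≤ N →
      ∀ x : Fin N → EuclideanSpace ℝ (Fin 3), Function.Injective x →
      ∀ dmin : ℝ, IsLeast {d : ℝ | ∃ i j : Fin N, i ≠ j ∧ d = dist (x i) (x j)} dmin →
      ∀ lam : ℝ, 0 < lam →
      (Mconc N x lam : ℝ) ≤ Mbar * N * lam ^ 3 →
      lam ^ 3 ≤ Ecal * dmin ^ 2 →
      lam < (3/2) * Mbar ^ (-(1:ℝ)/3) →
      ∀ i j : Fin N, i ≠ j →
        ‖(6 * Real.pi * (r0 / N)) • ∑ k ∈ Finset.univ.filter (fun k => k ≠ i), oseen (x i - x k) w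
          - (6 * Real.pi * (r0 / N)) • ∑ k ∈ Finset.univ.filter (fun k => k ≠ j), oseen (x j - x k) w‖
            ≤ C * dist (x i) (x j) := by
  set B : ℝ := Mbar * Ecal + 16 * Mbar * (1 + (3/2) * Mbar ^ (-(1:ℝ)/3)) + 1 with hB
  have hB0 : 0 < B := by positivity
  refine ⟨9 / 2 * r0 * ‖w‖ * B + 1, by positivity, ?_⟩
  intro N hN x hx d hd lam hlam hM hE hlam' i j hij
  have hN0 : (0 : ℝ) < N := by exact_mod_cast (by omega : 0 < N)
  have hd0 : 0 < d := by
    obtain ⟨a, b, hab, rfl⟩ := hd.1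
    exact dist_pos.2 (hx.ne hab)
  have hK : ∀ c, ((Finset.univ.filter fun i => linf (x i - c) ≤ lam).card : ℝ) ≤
      Mbar * N * lam ^ 3 := fun c =>
    le_trans (by exact_mod_cast card_filter_linf_le_Mconc x lam c) hM
  have hS : ∀ a, ∑ k with k ≠ a, (‖x a - x k‖ ^ 2)⁻¹ ≤ N * B := by
    intro a
    have h := sum_inv_sq_le x hlam hd0 hK a
      (fun k hk => hd.2 ⟨k, a, hk, (dist_eq_norm _ _).symm⟩)
    simp only [norm_sub_rev _ (x a)] at h
    refine h.trans ?_
    have h1 : Mbar * N * lam ^ 3 / d ^ 2 ≤ N * (Mbar * Ecal) := by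
      rw [div_le_iff₀ (by positivity)]
      calc Mbar * N * lam ^ 3 ≤ Mbar * N * (Ecal * d ^ 2) := by gcongr
        _ = _ := by ring
    have h2 : 16 * (Mbar * N * lam ^ 3) / lam ^ 3 * (1 + lam) ≤
        N * (16 * Mbar * (1 + (3/2) * Mbar ^ (-(1:ℝ)/3))) := by
      calc _ = N * (16 * Mbar * (1 + lam)) := by field_simp
        _ ≤ _ := by gcongr
    rw [hB]
    linarith
  rw [← smul_sub, sum_oseen_sub_sum_oseen x hij, norm_smul, Real.norm_of_nonneg (by positivity),
    dist_eq_norm]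
  have hmono : ∀ a, (a = i ∨ a = j) →
      ∑ k with k ≠ i ∧ k ≠ j, (‖x a - x k‖ ^ 2)⁻¹ ≤ N * B := by
    intro a ha
    refine le_trans (Finset.sum_le_sum_of_subset_of_nonneg ?_ fun _ _ _ => by positivity) (hS a)
    intro k
    simp only [Finset.mem_filter, Finset.mem_univ, true_and]
    rintro ⟨h1, h2⟩
    rcases ha with rfl | rfl <;> assumption
  have hsum : ‖∑ k with k ≠ i ∧ k ≠ j, (oseen (x i - x k) w - oseen (x j - x k) w)‖ ≤
      3 / (8 * Real.pi) * ‖w‖ * ‖x i - x j‖ * (2 * (N * B)) := by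
    calc _ ≤ ∑ k with k ≠ i ∧ k ≠ j, 3 / (8 * Real.pi) * ‖w‖ * ‖x i - x j‖ *
          ((‖x i - x k‖ ^ 2)⁻¹ + (‖x j - x k‖ ^ 2)⁻¹) := by
          refine norm_sum_le_of_le _ fun k hk => ?_
          obtain ⟨h1, h2⟩ := (Finset.mem_filter.1 hk).2
          have := norm_oseen_sub_oseen_le (sub_ne_zero.2 (hx.ne h1.symm))
            (sub_ne_zero.2 (hx.ne h2.symm)) w
          rwa [sub_sub_sub_cancel_right] at this
      _ ≤ _ := by
          rw [← Finset.mul_sum, Finset.sum_add_distrib, two_mul]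
          gcongr
          · exact hmono i (Or.inl rfl)
          · exact hmono j (Or.inr rfl)
  calc _ ≤ 6 * Real.pi * (r0 / N) *
        (3 / (8 * Real.pi) * ‖w‖ * ‖x i - x j‖ * (2 * (N * B))) := by gcongr
    _ = 9 / 2 * r0 * ‖w‖ * B * ‖x i - x j‖ := by
        have := Real.pi_pos
        field_simp
        ring
    _ ≤ _ := by
        gcongr
        linarith
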